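/- arXiv:2011.07857 — 5 statements merged into one kernel-verified Lean document; each statement's English description precedes it below -/
import Mathlib

section
/- Let F : ℝ → ℝ be continuous, let v ∈ ℝ, and let u⁺ < u⁻ be real numbers. Suppose (u, w) : ℝ → ℝ² is differentiable, satisfies the layer problem du/dξ = w, dw/dξ = v + F(u) on ℝ, and has the asymptotic limits u(ξ) → u⁻ and w(ξ) → 0 as ξ → −∞, and u(ξ) → u⁺ and w(ξ) → 0 as ξ → +∞. Then the equal area rule holds: ∫_{u⁺}^{u⁻} ( F(s) + v ) ds = 0. -/
theorem stmt_11 (F : ℝ → ℝ) (hF : Continuous F) (v : ℝ)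
    (up um : ℝ) (hlt : up < um)
    (u w : ℝ → ℝ) (hu : Differentiable ℝ u) (hw : Differentiable ℝ w)
    (hsys : ∀ ξ, deriv u ξ = w ξ ∧ deriv w ξ = v + F (u ξ))
    (hum : Filter.Tendsto u Filter.atBot (nhds um))
    (hwm : Filter.Tendsto w Filter.atBot (nhds 0))
    (hup : Filter.Tendsto u Filter.atTop (nhds up))
    (hwp : Filter.Tendsto w Filter.atTop (nhds 0)) :
    ∫ s in up..um, (F s + v) = 0 := by
  set G : ℝ → ℝ := fun x => ∫ s in up..x, (F s + v) with hG
  have hFv : Continuous fun s => F s + v := hF.add continuous_const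
  have hGd (x : ℝ) : HasDerivAt G (F x + v) x := hFv.integral_hasStrictDerivAt up x |>.hasDerivAt
  have hGc : Continuous G := continuous_iff_continuousAt.2 fun x => (hGd x).continuousAt
  -- the Hamiltonian of the layer problem is conserved
  have hH (ξ : ℝ) : HasDerivAt (fun ξ => w ξ ^ 2 / 2 - G (u ξ)) 0 ξ := by
    have hu' : HasDerivAt u (w ξ) ξ := (hsys ξ).1 ▸ (hu ξ).hasDerivAt
    have hw' : HasDerivAt w (v + F (u ξ)) ξ := (hsys ξ).2 ▸ (hw ξ).hasDerivAt
    have h := ((hw'.pow 2).div_const 2).sub ((hGd (u ξ)).comp ξ hu')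
    refine h.congr_deriv ?_
    push_cast
    ring
  have hconst (ξ : ℝ) : w ξ ^ 2 / 2 - G (u ξ) = w 0 ^ 2 / 2 - G (u 0) :=
    is_const_of_deriv_eq_zero (fun ξ => (hH ξ).differentiableAt) (fun ξ => (hH ξ).deriv) ξ 0
  have hlim {l : Filter ℝ} [l.NeBot] {a : ℝ} (hul : Filter.Tendsto u l (nhds a))
      (hwl : Filter.Tendsto w l (nhds 0)) : 0 ^ 2 / 2 - G a = w 0 ^ 2 / 2 - G (u 0) := by
    have h := ((hwl.pow 2).div_const 2).sub ((hGc.tendsto a).comp hul)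
    exact tendsto_nhds_unique h (tendsto_const_nhds.congr fun ξ => (hconst ξ).symm)
  have hGup : G up = 0 := intervalIntegral.integral_same
  change G um = 0
  linarith [hlim hum hwm, hlim hup hwp]
end

section
/- Let a > 0 and u⁺ < u⁻ be real numbers, let v ∈ ℝ, and let F : ℝ → ℝ satisfy F(s) + v = a² (s − u⁺)(s − u⁻)(2s − u⁺ − u⁻) for all s ∈ ℝ. Define u_h(ξ) = (u⁻ + u⁺)/2 + ((u⁻ − u⁺)/2) tanh( −(a(u⁻ − u⁺)/2) ξ ) and w_h(ξ) = −(a (u⁻ − u⁺)²/4) sech²( −(a(u⁻ − u⁺)/2) ξ ). Then (u_h, w_h) solves the layer problem du/dξ = w, dw/dξ = v + F(u) on ℝ, and lim_{ξ→−∞}(u_h, w_h)(ξ) = (u⁻, 0), lim_{ξ→+∞}(u_h, w_h)(ξ) = (u⁺, 0); that is, (u_h, w_h) is a heteroclinic orbit of the layer problem connecting (u⁻, 0) to (u⁺, 0). -/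
theorem Real.one_div_cosh_sq (x : ℝ) : (1 / Real.cosh x) ^ 2 = 1 - Real.tanh x ^ 2 := by
  have h := (Real.cosh_pos x).ne'
  rw [Real.tanh_eq_sinh_div_cosh]
  field_simp
  linarith [Real.cosh_sq x]

theorem Real.hasDerivAt_tanh_one_sub_sq (x : ℝ) :
    HasDerivAt Real.tanh (1 - Real.tanh x ^ 2) x := by
  have h := (Real.hasDerivAt_sinh x).fun_div (Real.hasDerivAt_cosh x) (Real.cosh_pos x).ne'
  simp only [← Real.tanh_eq_sinh_div_cosh] at h
  refine h.congr_deriv ?_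
  have := (Real.cosh_pos x).ne'
  rw [Real.tanh_eq_sinh_div_cosh]
  field_simp

theorem Real.tendsto_tanh_atTop_one : Filter.Tendsto Real.tanh Filter.atTop (nhds 1) := by
  have heq : Real.tanh = fun x => 1 - 2 / (Real.exp (2 * x) + 1) := by
    ext x
    have hx := Real.exp_pos x
    rw [Real.tanh_eq_sinh_div_cosh, Real.sinh_eq, Real.cosh_eq, Real.exp_neg, two_mul x,
      Real.exp_add]
    field_simp
    ring
  have hexp : Filter.Tendsto (fun x : ℝ => Real.exp (2 * x) + 1) Filter.atTop Filter.atTop :=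
    Filter.tendsto_atTop_add_const_right _ _
      (Real.tendsto_exp_atTop.comp (Filter.tendsto_id.const_mul_atTop two_pos))
  rw [heq]
  simpa using (hexp.const_div_atTop 2).const_sub 1

theorem Real.tendsto_tanh_atBot_neg_one :
    Filter.Tendsto Real.tanh Filter.atBot (nhds (-1)) := by
  have h := (Real.tendsto_tanh_atTop_one.comp Filter.tendsto_neg_atBot_atTop).neg
  simpa [Function.comp_def] using h

theorem stmt_13 (a : ℝ) (ha : 0 < a) (up um : ℝ) (hlt : up < um) (v : ℝ)
    (F : ℝ → ℝ) (hF : ∀ s, F s + v = a ^ 2 * (s - up) * (s - um) * (2 * s - up - um))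
    (uh wh : ℝ → ℝ)
    (huh : ∀ ξ, uh ξ = (um + up) / 2 + (um - up) / 2 * Real.tanh (-(a * (um - up) / 2) * ξ))
    (hwh : ∀ ξ, wh ξ = -(a * (um - up) ^ 2 / 4) *
      (1 / Real.cosh (-(a * (um - up) / 2) * ξ)) ^ 2) :
    (∀ ξ, deriv uh ξ = wh ξ) ∧
    (∀ ξ, deriv wh ξ = v + F (uh ξ)) ∧
    Filter.Tendsto (fun ξ => (uh ξ, wh ξ)) Filter.atBot (nhds (um, 0)) ∧
    Filter.Tendsto (fun ξ => (uh ξ, wh ξ)) Filter.atTop (nhds (up, 0)) := by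
  have hk : -(a * (um - up) / 2) < 0 := by
    have := mul_pos ha (sub_pos.2 hlt)
    linarith
  simp only [Real.one_div_cosh_sq] at hwh
  have htanh (ξ : ℝ) : HasDerivAt (fun ξ => Real.tanh (-(a * (um - up) / 2) * ξ))
      ((1 - Real.tanh (-(a * (um - up) / 2) * ξ) ^ 2) * (-(a * (um - up) / 2) * 1)) ξ :=
    (Real.hasDerivAt_tanh_one_sub_sq _).comp ξ ((hasDerivAt_id ξ).const_mul _)
  have hlim {l : Filter ℝ} {t : ℝ} (ht : t ^ 2 = 1)
      (h : Filter.Tendsto (fun ξ => Real.tanh (-(a * (um - up) / 2) * ξ)) l (nhds t)) :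
      Filter.Tendsto (fun ξ => (uh ξ, wh ξ)) l
        (nhds ((um + up) / 2 + (um - up) / 2 * t, 0)) := by
    simp only [huh, hwh]
    refine ((h.const_mul _).const_add _).prodMk_nhds ?_
    simpa [ht] using ((h.pow 2).const_sub 1).const_mul (-(a * (um - up) ^ 2 / 4))
  refine ⟨fun ξ => ?_, fun ξ => ?_, ?_, ?_⟩
  · rw [funext huh, (((htanh ξ).const_mul _).const_add _).deriv, hwh]
    ring
  · rw [funext hwh, ((((htanh ξ).fun_pow 2).const_sub 1).const_mul _).deriv, add_comm, hF, huh]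
    push_cast
    ring
  · convert hlim (one_pow 2) (Real.tendsto_tanh_atTop_one.comp
      (Filter.tendsto_id.const_mul_atBot_of_neg hk)) using 3
    ring
  · convert hlim (by norm_num) (Real.tendsto_tanh_atBot_neg_one.comp
      (Filter.tendsto_id.const_mul_atTop_of_neg hk)) using 3
    ring
end

section
/- Let D, R : ℝ → ℝ be continuous, let c < 0, and let 0 < u_a. Suppose g : [0, u_a] → ℝ is continuously differentiable with g(0) = 0, g(u) < 0 for all u ∈ (0, u_a], and g(u)·(g′(u) + c) = −R(u) D(u) for all u ∈ [0, u_a]. Then ∫₀^{u_a} D(u) R(u) du < −g(u_a)²/2 < 0. In particular, a necessary condition for a monotonically decreasing shock-fronted left-travelling wave is that ∫₀^{u_a} D(u) R(u) du < 0. -/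
theorem stmt_14 (D R : ℝ → ℝ) (hD : Continuous D) (hR : Continuous R)
    (c : ℝ) (hc : c < 0) (ua : ℝ) (hua : 0 < ua)
    (g g' : ℝ → ℝ)
    (hg' : ContinuousOn g' (Set.Icc 0 ua))
    (hderiv : ∀ x ∈ Set.Icc (0 : ℝ) ua, HasDerivWithinAt g (g' x) (Set.Icc 0 ua) x)
    (hg0 : g 0 = 0)
    (hgneg : ∀ x ∈ Set.Ioc (0 : ℝ) ua, g x < 0)
    (heq : ∀ x ∈ Set.Icc (0 : ℝ) ua, g x * (g' x + c) = -(R x * D x)) :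
    (∫ x in (0 : ℝ)..ua, D x * R x) < -(g ua) ^ 2 / 2 ∧ -(g ua) ^ 2 / 2 < 0 := by
  have hgc : ContinuousOn g (Set.Icc 0 ua) := fun x hx => (hderiv x hx).continuousWithinAt
  have hcg : IntervalIntegrable (fun x => c * g x) MeasureTheory.volume 0 ua :=
    (continuousOn_const.mul hgc).intervalIntegrable_of_Icc hua.le
  have hDR : IntervalIntegrable (fun x => D x * R x) MeasureTheory.volume 0 ua :=
    (hD.mul hR).intervalIntegrable 0 ua
  have hftc : ∫ x in (0 : ℝ)..ua, (D x * R x + c * g x) = -(g ua) ^ 2 / 2 - -(g 0) ^ 2 / 2 := by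
    refine intervalIntegral.integral_eq_sub_of_hasDerivAt_of_le (f := fun x => -(g x) ^ 2 / 2)
      hua.le ((hgc.pow 2).neg.div_const 2) (fun x hx => ?_) (hDR.add hcg)
    have hxI := Set.Ioo_subset_Icc_self hx
    have hd := (hderiv x hxI).hasDerivAt (Icc_mem_nhds hx.1 hx.2)
    refine ((hd.pow 2).neg.div_const 2).congr_deriv ?_
    norm_num
    linarith [heq x hxI]
  have hpos : 0 < ∫ x in (0 : ℝ)..ua, c * g x :=
    intervalIntegral.intervalIntegral_pos_of_pos_on hcg
      (fun x hx => mul_pos_of_neg_of_neg hc (hgneg x (Set.Ioo_subset_Ioc_self hx))) hua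
  rw [intervalIntegral.integral_add hDR hcg, hg0] at hftc
  have hsq : 0 < (g ua) ^ 2 := sq_pos_of_neg (hgneg ua ⟨hua, le_rfl⟩)
  constructor <;> linarith
end

section
/- Let D, R : ℝ → ℝ be continuous, let c > 0, and let u_b < 1. Suppose g : [u_b, 1] → ℝ is continuously differentiable with g(1) = 0, g(u) < 0 for all u ∈ [u_b, 1), and g(u)·(g′(u) + c) = −R(u) D(u) for all u ∈ [u_b, 1]. Then ∫_{u_b}^{1} D(u) R(u) du > g(u_b)²/2 > 0. In particular, a necessary condition for a monotonically decreasing shock-fronted right-travelling wave is that ∫_{u_b}^{1} D(u) R(u) du > 0. -/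
theorem stmt_15 (D R : ℝ → ℝ) (hD : Continuous D) (hR : Continuous R)
    (c : ℝ) (hc : c > 0) (ub : ℝ) (hub : ub < 1)
    (g g' : ℝ → ℝ)
    (hg' : ContinuousOn g' (Set.Icc ub 1))
    (hderiv : ∀ x ∈ Set.Icc ub (1 : ℝ), HasDerivWithinAt g (g' x) (Set.Icc ub 1) x)
    (hg1 : g 1 = 0)
    (hgneg : ∀ x ∈ Set.Ico ub (1 : ℝ), g x < 0)
    (heq : ∀ x ∈ Set.Icc ub (1 : ℝ), g x * (g' x + c) = -(R x * D x)) :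
    (∫ x in ub..(1 : ℝ), D x * R x) > (g ub) ^ 2 / 2 ∧ (g ub) ^ 2 / 2 > 0 := by
  have hle : ub ≤ 1 := hub.le
  have hg : ContinuousOn g (Set.Icc ub 1) := fun x hx => (hderiv x hx).continuousWithinAt
  have hint_g : IntervalIntegrable g MeasureTheory.volume ub 1 :=
    hg.intervalIntegrable_of_Icc hle
  have hint_gg' : IntervalIntegrable (fun x => g x * g' x) MeasureTheory.volume ub 1 :=
    (hg.mul hg').intervalIntegrable_of_Icc hle
  have hftc : ∫ x in ub..(1 : ℝ), g x * g' x = g 1 ^ 2 / 2 - g ub ^ 2 / 2 := by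
    refine intervalIntegral.integral_eq_sub_of_hasDerivAt_of_le (f := fun x => g x ^ 2 / 2) hle
      ((hg.pow 2).div_const 2) (fun x hx => ?_) hint_gg'
    have hgx : HasDerivAt g (g' x) x :=
      (hderiv x (Set.Ioo_subset_Icc_self hx)).hasDerivAt (Icc_mem_nhds hx.1 hx.2)
    refine ((hgx.pow 2).div_const 2).congr_deriv ?_
    push_cast
    ring
  have hpos : 0 < ∫ x in ub..(1 : ℝ), -g x :=
    intervalIntegral.intervalIntegral_pos_of_pos_on hint_g.neg
      (fun x hx => neg_pos.mpr (hgneg x (Set.Ioo_subset_Ico_self hx))) hub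
  have hint_neg : IntervalIntegrable (fun x => -(g x * g' x)) MeasureTheory.volume ub 1 :=
    hint_gg'.neg
  have hint_cg : IntervalIntegrable (fun x => c * -g x) MeasureTheory.volume ub 1 :=
    hint_g.neg.const_mul c
  have hsplit : ∫ x in ub..(1 : ℝ), D x * R x =
      -(∫ x in ub..(1 : ℝ), g x * g' x) + c * ∫ x in ub..(1 : ℝ), -g x := by
    rw [← intervalIntegral.integral_neg, ← intervalIntegral.integral_const_mul,
      ← intervalIntegral.integral_add hint_neg hint_cg]
    refine intervalIntegral.integral_congr fun x hx => ?_
    rw [Set.uIcc_of_le hle] at hx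
    linear_combination heq x hx
  have hgub : g ub < 0 := hgneg ub ⟨le_rfl, hub⟩
  refine ⟨?_, by nlinarith⟩
  rw [hsplit, hftc, hg1]
  nlinarith [mul_pos hc hpos]
end

section
/- Let D, R : ℝ → ℝ be continuous, let c ∈ ℝ, and let 0 < u_a. Suppose g : [0, u_a] → ℝ is continuously differentiable with g(0) = 0, g(u) < 0 for all u ∈ (0, u_a], and g(u)·(g′(u) + c) = −R(u) D(u) for all u ∈ [0, u_a]. Then ∫₀^{u_a} g(u) du < 0 and the wave speed is given by c = −( ∫₀^{u_a} R(u) D(u) du + g(u_a)²/2 ) / ( ∫₀^{u_a} g(u) du ). -/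
theorem stmt_16 (D R : ℝ → ℝ) (hD : Continuous D) (hR : Continuous R)
    (c : ℝ) (ua : ℝ) (hua : 0 < ua)
    (g g' : ℝ → ℝ)
    (hg' : ContinuousOn g' (Set.Icc 0 ua))
    (hderiv : ∀ x ∈ Set.Icc (0 : ℝ) ua, HasDerivWithinAt g (g' x) (Set.Icc 0 ua) x)
    (hg0 : g 0 = 0)
    (hgneg : ∀ x ∈ Set.Ioc (0 : ℝ) ua, g x < 0)
    (heq : ∀ x ∈ Set.Icc (0 : ℝ) ua, g x * (g' x + c) = -(R x * D x)) :
    (∫ x in (0 : ℝ)..ua, g x) < 0 ∧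
      c = -(((∫ x in (0 : ℝ)..ua, R x * D x) + (g ua) ^ 2 / 2) /
        (∫ x in (0 : ℝ)..ua, g x)) := by
  have hcont : ContinuousOn g (Set.Icc 0 ua) := fun x hx => (hderiv x hx).continuousWithinAt
  have hint : IntervalIntegrable g MeasureTheory.volume 0 ua :=
    hcont.intervalIntegrable_of_Icc hua.le
  have hint_mul : IntervalIntegrable (fun x => g x * g' x) MeasureTheory.volume 0 ua :=
    (hcont.mul hg').intervalIntegrable_of_Icc hua.le
  have hneg : (∫ x in (0 : ℝ)..ua, g x) < 0 := by
    have h := intervalIntegral.intervalIntegral_pos_of_pos_on hint.neg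
      (fun x hx => neg_pos.mpr (hgneg x (Set.Ioo_subset_Ioc_self hx))) hua
    simpa using h
  refine ⟨hneg, ?_⟩
  have hsq : (∫ x in (0 : ℝ)..ua, g x * g' x) = g ua ^ 2 / 2 := by
    rw [intervalIntegral.integral_eq_sub_of_hasDerivAt_of_le hua.le
      (f := fun x => g x ^ 2 / 2) ((hcont.pow 2).div_const 2) (fun x hx => ?_) hint_mul]
    · simp [hg0]
    · have h := (hderiv x (Set.Ioo_subset_Icc_self hx)).hasDerivAt (Icc_mem_nhds hx.1 hx.2)
      exact ((h.pow 2).div_const 2).congr_deriv (by norm_num; ring)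
  have hRD : (∫ x in (0 : ℝ)..ua, R x * D x) =
      -((∫ x in (0 : ℝ)..ua, g x * g' x) + c * ∫ x in (0 : ℝ)..ua, g x) := by
    rw [← intervalIntegral.integral_const_mul,
      ← intervalIntegral.integral_add hint_mul (hint.const_mul c),
      ← intervalIntegral.integral_neg]
    refine intervalIntegral.integral_congr fun x hx => ?_
    rw [Set.uIcc_of_le hua.le] at hx
    linear_combination heq x hx
  rw [hRD, hsq, ← neg_div, eq_div_iff hneg.ne]
  ring
end
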